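/- Let θ ∈ ℝ and let G be a finite connected θ-critical simple graph (every vertex of G is θ-essential). Then for every vertex u of G, no vertex of G−u is θ-essential in G−u: for every vertex w ≠ u, mult(θ, (G−u)−w) ≠ mult(θ, G−u) − 1. -/

import Mathlib

open Polynomial

/-- The matching polynomial of a finite simple graph `G`:
`μ(G,z) = ∑_k (-1)^k p(k,G) z^(n-2k)`, written as a sum over all matchings
(finsets of pairwise disjoint edges). -/
noncomputable def matchingPolynomial {V : Type*} [Finite V] (G : SimpleGraph V) :
    Polynomial ℝ := by
  classical
  have : Fintype V := Fintype.ofFinite V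
  exact ∑ M ∈ Finset.univ.filter
      (fun M : Finset (Sym2 V) =>
        (∀ e ∈ M, e ∈ G.edgeSet) ∧ ∀ e ∈ M, ∀ f ∈ M, e ≠ f → ∀ v, v ∈ e → v ∉ f),
    (-1 : Polynomial ℝ) ^ M.card * X ^ (Nat.card V - 2 * M.card)

/-- `matchMult θ G` is the multiplicity of `θ` as a root of the matching polynomial
of `G` (equal to `0` if `θ` is not a root). -/
noncomputable def matchMult {V : Type*} [Finite V] (θ : ℝ) (G : SimpleGraph V) : ℕ :=
  Polynomial.rootMultiplicity θ (matchingPolynomial G)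

/-- A vertex `u` is `θ`-essential if `mult(θ, G-u) = mult(θ, G) - 1`. -/
def IsEssential {V : Type*} [Finite V] (θ : ℝ) (G : SimpleGraph V) (u : V) : Prop :=
  matchMult θ (G.induce {v | v ≠ u}) + 1 = matchMult θ G

/-- A vertex `u` is `θ`-positive if `mult(θ, G-u) = mult(θ, G) + 1`. -/
def IsPositive {V : Type*} [Finite V] (θ : ℝ) (G : SimpleGraph V) (u : V) : Prop :=
  matchMult θ (G.induce {v | v ≠ u}) = matchMult θ G + 1

/-- A vertex `u` is `θ`-neutral if `mult(θ, G-u) = mult(θ, G)`. -/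
def IsNeutral {V : Type*} [Finite V] (θ : ℝ) (G : SimpleGraph V) (u : V) : Prop :=
  matchMult θ (G.induce {v | v ≠ u}) = matchMult θ G

/-- A vertex is `θ`-special if it is not `θ`-essential but has a `θ`-essential neighbor. -/
def IsSpecial {V : Type*} [Finite V] (θ : ℝ) (G : SimpleGraph V) (u : V) : Prop :=
  ¬ IsEssential θ G u ∧ ∃ w, G.Adj u w ∧ IsEssential θ G w

/-- The outer vertex boundary `∂S`: vertices not in `S` with a neighbor in `S`. -/
def vertexBoundary {V : Type*} (G : SimpleGraph V) (S : Set V) : Set V :=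
  {v | v ∉ S ∧ ∃ w ∈ S, G.Adj v w}

namespace MatchAux

open Finset

variable {V : Type*} [Fintype V] [DecidableEq V]

/-- matchings of `G` inside `S` -/
noncomputable def ms (G : SimpleGraph V) (S : Finset V) : Finset (Finset (Sym2 V)) := by
  classical
  exact Finset.univ.filter (fun M : Finset (Sym2 V) =>
        (∀ e ∈ M, e ∈ G.edgeSet) ∧ (∀ e ∈ M, ∀ f ∈ M, e ≠ f → ∀ v, v ∈ e → v ∉ f) ∧
        ∀ e ∈ M, ∀ v ∈ e, v ∈ S)

/-- weighted matching polynomial of the subgraph induced on `S` -/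
noncomputable def mp {R : Type*} [CommRing R] (G : SimpleGraph V) (x : V → R) (S : Finset V) : R := by
  classical
  exact ∑ M ∈ ms G S, (-1) ^ M.card * ∏ v ∈ S.filter (fun v => ∀ e ∈ M, v ∉ e), x v

lemma mem_ms {G : SimpleGraph V} {S : Finset V} {M : Finset (Sym2 V)} :
    M ∈ ms G S ↔ (∀ e ∈ M, e ∈ G.edgeSet) ∧
      (∀ e ∈ M, ∀ f ∈ M, e ≠ f → ∀ v, v ∈ e → v ∉ f) ∧ ∀ e ∈ M, ∀ v ∈ e, v ∈ S := by
  classical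
  simp [ms]

lemma mp_map {R R' : Type*} [CommRing R] [CommRing R'] (f : R →+* R') (G : SimpleGraph V)
    (x : V → R) (S : Finset V) : f (mp G x S) = mp G (fun v => f (x v)) S := by
  classical
  simp [mp, map_sum, map_prod]

lemma mp_congr {R : Type*} [CommRing R] (G : SimpleGraph V) {x y : V → R} {S : Finset V}
    (h : ∀ v ∈ S, x v = y v) : mp G x S = mp G y S := by
  classical
  unfold mp
  refine Finset.sum_congr rfl fun M _ => ?_
  congr 1
  refine Finset.prod_congr rfl fun v hv => h v (Finset.mem_filter.1 hv).1

lemma mp_empty {R : Type*} [CommRing R] (G : SimpleGraph V) (x : V → R) : mp G x ∅ = 1 := by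
  classical
  have : ms G (∅ : Finset V) = {∅} := by
    ext M
    rw [mem_ms, Finset.mem_singleton]
    constructor
    · rintro ⟨-, -, h⟩
      by_contra hM
      obtain ⟨e, he⟩ := Finset.nonempty_iff_ne_empty.2 hM
      induction e using Sym2.ind with
      | _ a b => simpa using h _ he a (by simp)
    · rintro rfl; simp
  simp [mp, this]

open Classical in
lemma ms_split (G : SimpleGraph V) (S : Finset V) (u : V) (hu : u ∈ S) :
    ms G S = ms G (S.erase u) ∪ ((S.erase u).filter (fun v => G.Adj u v)).biUnion
      (fun v => (ms G ((S.erase u).erase v)).image (insert s(u,v))) := by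
  ext M
  simp only [Finset.mem_union, Finset.mem_biUnion, Finset.mem_image, Finset.mem_filter]
  constructor
  · intro h
    rw [mem_ms] at h
    obtain ⟨h1, h2, h3⟩ := h
    by_cases hc : ∃ e ∈ M, u ∈ e
    · right
      obtain ⟨e, he, hue⟩ := hc
      obtain ⟨v, rfl⟩ := Sym2.mem_iff_exists.1 hue
      have hadj : G.Adj u v := h1 _ he
      refine ⟨v, ⟨Finset.mem_erase.2 ⟨hadj.ne', h3 _ he v (by simp)⟩, hadj⟩, M.erase s(u,v), ?_,
        Finset.insert_erase he⟩
      rw [mem_ms]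
      refine ⟨fun e he' => h1 e (Finset.mem_of_mem_erase he'),
        fun e he' f hf => h2 e (Finset.mem_of_mem_erase he') f (Finset.mem_of_mem_erase hf), ?_⟩
      intro e he' y hy
      rw [Finset.mem_erase] at he'
      have := h2 e he'.2 _ he he'.1 y hy
      simp only [Sym2.mem_iff, not_or] at this
      simp only [Finset.mem_erase]
      exact ⟨this.2, this.1, h3 e he'.2 y hy⟩
    · left
      push Not at hc
      rw [mem_ms]
      refine ⟨h1, h2, fun e he v hv => Finset.mem_erase.2 ⟨?_, h3 e he v hv⟩⟩
      rintro rfl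
      exact hc e he hv
  · rintro (h | ⟨v, ⟨hv, hadj⟩, M', hM', rfl⟩)
    · rw [mem_ms] at h ⊢
      exact ⟨h.1, h.2.1, fun e he v hv => Finset.mem_of_mem_erase (h.2.2 e he v hv)⟩
    · rw [mem_ms] at hM' ⊢
      obtain ⟨h1, h2, h3⟩ := hM'
      have key : ∀ f ∈ M', ∀ y ∈ f, y ≠ u ∧ y ≠ v := by
        intro f hf y hy
        have := h3 f hf y hy
        simp only [Finset.mem_erase] at this
        exact ⟨this.2.1, this.1⟩
      refine ⟨?_, ?_, ?_⟩
      · intro e he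
        rcases Finset.mem_insert.1 he with rfl | he
        · exact hadj
        · exact h1 e he
      · intro e he f hf hne y hye hyf
        rcases Finset.mem_insert.1 he with rfl | he <;> rcases Finset.mem_insert.1 hf with rfl | hf
        · exact hne rfl
        · have := key f hf y hyf
          simp only [Sym2.mem_iff] at hye
          tauto
        · have := key e he y hye
          simp only [Sym2.mem_iff] at hyf
          tauto
        · exact h2 e he f hf hne y hye hyf
      · intro e he y hy
        rcases Finset.mem_insert.1 he with rfl | he
        · simp only [Sym2.mem_iff] at hy
          rcases hy with rfl | rfl
          · exact hu
          · exact Finset.mem_of_mem_erase hv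
        · exact Finset.mem_of_mem_erase (Finset.mem_of_mem_erase (h3 e he y hy))

open Classical in
lemma mp_rec {R : Type*} [CommRing R] (G : SimpleGraph V) (x : V → R) (S : Finset V) (u : V)
    (hu : u ∈ S) :
    mp G x S = x u * mp G x (S.erase u)
      - ∑ v ∈ (S.erase u).filter (fun v => G.Adj u v), mp G x ((S.erase u).erase v) := by
  have hnot : ∀ v, ∀ M ∈ ms G ((S.erase u).erase v), ∀ y, (y = u ∨ y = v) → ∀ f ∈ M, y ∉ f := by
    intro v M hM y hy f hf hyf
    have := (mem_ms.1 hM).2.2 f hf y hyf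
    simp only [Finset.mem_erase] at this
    tauto
  have hnot1 : ∀ M ∈ ms G (S.erase u), ∀ f ∈ M, u ∉ f := by
    intro M hM f hf hyf
    have := (mem_ms.1 hM).2.2 f hf u hyf
    simp at this
  unfold mp
  rw [ms_split G S u hu, Finset.sum_union, sub_eq_add_neg]
  · congr 1
    · rw [Finset.mul_sum]
      refine Finset.sum_congr rfl fun M hM => ?_
      have : S.filter (fun v => ∀ e ∈ M, v ∉ e) =
          insert u ((S.erase u).filter (fun v => ∀ e ∈ M, v ∉ e)) := by
        ext y
        simp only [Finset.mem_filter, Finset.mem_insert, Finset.mem_erase]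
        constructor
        · rintro ⟨h1, h2⟩
          by_cases h : y = u
          · exact Or.inl h
          · exact Or.inr ⟨⟨h, h1⟩, h2⟩
        · rintro (rfl | ⟨⟨-, h1⟩, h2⟩)
          · exact ⟨hu, hnot1 M hM⟩
          · exact ⟨h1, h2⟩
      rw [this, Finset.prod_insert (by simp)]
      ring
    · rw [Finset.sum_biUnion, ← Finset.sum_neg_distrib]
      · refine Finset.sum_congr rfl fun v hv => ?_
        rw [Finset.sum_image, ← Finset.sum_neg_distrib]
        · refine Finset.sum_congr rfl fun M hM => ?_
          have hnm : s(u,v) ∉ M := fun h => hnot v M hM u (Or.inl rfl) _ h (by simp)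
          rw [Finset.card_insert_of_notMem hnm]
          have : S.filter (fun y => ∀ e ∈ insert s(u,v) M, y ∉ e) =
              ((S.erase u).erase v).filter (fun v => ∀ e ∈ M, v ∉ e) := by
            ext y
            simp only [Finset.mem_filter, Finset.mem_insert, Finset.mem_erase,
              forall_eq_or_imp, Sym2.mem_iff, not_or]
            tauto
          rw [this]
          ring
        · intro M hM N hN h
          have h1 : s(u,v) ∉ M := fun h => hnot v M hM u (Or.inl rfl) _ h (by simp)
          have h2 : s(u,v) ∉ N := fun h => hnot v N hN u (Or.inl rfl) _ h (by simp)
          rw [← Finset.erase_insert h1, ← Finset.erase_insert h2]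
          exact congrArg (fun T => Finset.erase T s(u,v)) h
      · intro v hv v' hv' hne
        refine Finset.disjoint_left.2 ?_
        intro M hM hM'
        obtain ⟨N, hN, rfl⟩ := Finset.mem_image.1 hM
        obtain ⟨N', hN', h⟩ := Finset.mem_image.1 hM'
        have : s(u,v) ∈ insert s(u,v') N' := by rw [h]; simp
        rcases Finset.mem_insert.1 this with h | h
        · exact hne (Sym2.congr_right.1 h)
        · exact hnot v' N' hN' u (Or.inl rfl) _ h (by simp)
  · refine Finset.disjoint_left.2 ?_
    intro M hM hM'
    obtain ⟨v, hv, hM'⟩ := Finset.mem_biUnion.1 hM'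
    obtain ⟨N', hN', rfl⟩ := Finset.mem_image.1 hM'
    exact hnot1 _ hM s(u,v) (by simp) (by simp)

/-- Heilmann-Lieb type inequality. -/
lemma hl (G : SimpleGraph V) (x : V → ℝ) : ∀ (n : ℕ) (S : Finset V), S.card = n →
    ∀ u w, u ∈ S → w ∈ S → u ≠ w →
    0 ≤ mp G x (S.erase u) * mp G x (S.erase w) - mp G x S * mp G x ((S.erase u).erase w) := by
  classical
  intro n
  induction n with
  | zero => intro S hS u w hu; simp [Finset.card_eq_zero.1 hS] at hu
  | succ n ih =>
    intro S hS u w hu hw huw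
    have hwu : w ∈ S.erase u := Finset.mem_erase.2 ⟨huw.symm, hw⟩
    have huw' : u ∈ S.erase w := Finset.mem_erase.2 ⟨huw, hu⟩
    have e1 := mp_rec G x S u hu
    have e2 := mp_rec G x (S.erase w) u huw'
    rw [Finset.erase_right_comm (a := w) (b := u)] at e2
    set T := ((S.erase u).erase w).filter (fun v => G.Adj u v) with hT
    have hsum : ∑ v ∈ (S.erase u).filter (fun v => G.Adj u v), mp G x ((S.erase u).erase v)
        = (if G.Adj u w then mp G x ((S.erase u).erase w) else 0)
          + ∑ v ∈ T, mp G x ((S.erase u).erase v) := by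
      by_cases hadj : G.Adj u w
      · have : (S.erase u).filter (fun v => G.Adj u v) = insert w T := by
          ext y
          simp only [hT, Finset.mem_filter, Finset.mem_insert, Finset.mem_erase]
          constructor
          · intro h
            by_cases hy : y = w
            · exact Or.inl hy
            · exact Or.inr ⟨⟨hy, h.1⟩, h.2⟩
          · rintro (rfl | h)
            · exact ⟨⟨huw.symm, hw⟩, hadj⟩
            · exact ⟨h.1.2, h.2⟩
        rw [this, Finset.sum_insert (by simp [hT]), if_pos hadj]
      · have : (S.erase u).filter (fun v => G.Adj u v) = T := by
          ext y
          simp only [hT, Finset.mem_filter, Finset.mem_erase]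
          constructor
          · intro h
            refine ⟨⟨?_, h.1⟩, h.2⟩
            rintro rfl; exact hadj h.2
          · intro h; exact ⟨h.1.2, h.2⟩
        rw [this, if_neg hadj, zero_add]
    rw [hsum] at e1
    have hnn : 0 ≤ ∑ v ∈ T, (mp G x ((S.erase u).erase v) * mp G x ((S.erase u).erase w)
        - mp G x (S.erase u) * mp G x (((S.erase u).erase w).erase v)) := by
      refine Finset.sum_nonneg fun v hv => ?_
      simp only [hT, Finset.mem_filter, Finset.mem_erase] at hv
      have := ih (S.erase u) (by rw [Finset.card_erase_of_mem hu, hS]; rfl) v w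
        (Finset.mem_erase.2 hv.1.2) hwu hv.1.1
      rwa [Finset.erase_right_comm (a := v) (b := w)] at this
    rw [Finset.sum_sub_distrib, ← Finset.sum_mul, ← Finset.mul_sum] at hnn
    have hsq : 0 ≤ (if G.Adj u w then mp G x ((S.erase u).erase w) else 0) *
        mp G x ((S.erase u).erase w) := by
      split_ifs
      · exact mul_self_nonneg _
      · simp
    rw [e1, e2]
    nlinarith [hnn, hsq]

/-- polynomial of the induced subgraph -/
noncomputable def ph (G : SimpleGraph V) (S : Finset V) : ℝ[X] := mp G (fun _ => X) S

lemma ph_eval (G : SimpleGraph V) (S : Finset V) (t : ℝ) :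
    (ph G S).eval t = mp G (fun _ => t) S := by
  have := mp_map (Polynomial.evalRingHom t) G (fun _ => X) S
  simpa [ph] using this

lemma mp_shift (G : SimpleGraph V) (t c : ℝ) (S : Finset V) (v : V) (hv : v ∈ S) :
    mp G (Function.update (fun _ => t) v (t + c)) S
      = (ph G S).eval t + c * (ph G (S.erase v)).eval t := by
  classical
  have hc : ∀ T : Finset V, v ∉ T →
      mp G (Function.update (fun _ => t) v (t + c)) T = mp G (fun _ => t) T := by
    intro T hT
    refine mp_congr G fun y hy => ?_
    rw [Function.update_of_ne]
    rintro rfl; exact hT hy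
  rw [ph_eval, ph_eval, mp_rec G _ S v hv, mp_rec G (fun _ => t) S v hv, hc _ (by simp)]
  rw [Finset.sum_congr rfl (fun y _ => hc ((S.erase v).erase y) (by simp))]
  simp only [Function.update_self]
  ring

lemma ph_monic (G : SimpleGraph V) : ∀ (n : ℕ) (S : Finset V), S.card = n →
    (ph G S).Monic ∧ (ph G S).natDegree = n := by
  classical
  intro n
  induction n using Nat.strong_induction_on with
  | _ n ih =>
    intro S hS
    rcases S.eq_empty_or_nonempty with rfl | ⟨u, hu⟩
    · simp at hS; subst hS
      simp [ph, mp_empty]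
    · have hpos : 0 < S.card := Finset.card_pos.2 ⟨u, hu⟩
      have hc : (S.erase u).card = n - 1 := by rw [Finset.card_erase_of_mem hu, hS]
      obtain ⟨m1, d1⟩ := ih (n-1) (by omega) _ hc
      have e : ph G S = _ := mp_rec G (fun _ => X) S u hu
      change ph G S = X * ph G (S.erase u) - ∑ v ∈ (S.erase u).filter (fun v => G.Adj u v),
        ph G ((S.erase u).erase v) at e
      have mX : (X * ph G (S.erase u)).Monic := monic_X.mul m1
      have dX : (X * ph G (S.erase u)).natDegree = n := by
        rw [monic_X.natDegree_mul m1, d1, natDegree_X]; omega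
      have dlt : (∑ v ∈ (S.erase u).filter (fun v => G.Adj u v),
          ph G ((S.erase u).erase v)).degree < (X * ph G (S.erase u)).degree := by
        rw [degree_eq_natDegree mX.ne_zero, dX]
        refine lt_of_le_of_lt (degree_sum_le _ _) ?_
        rw [Finset.sup_lt_iff (by exact WithBot.bot_lt_coe n)]
        intro v hv
        have hv' := (Finset.mem_filter.1 hv).1
        have hc2 : ((S.erase u).erase v).card = n - 1 - 1 := by
          rw [Finset.card_erase_of_mem hv', hc]
        have : 0 < (S.erase u).card := Finset.card_pos.2 ⟨v, hv'⟩
        obtain ⟨m2, d2⟩ := ih (n-1-1) (by omega) _ hc2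
        rw [degree_eq_natDegree m2.ne_zero, d2]
        exact_mod_cast (by omega : n - 1 - 1 < n)
      rw [e]
      refine ⟨mX.sub_of_left dlt, ?_⟩
      rw [← dX]
      exact natDegree_eq_of_degree_eq (degree_sub_eq_left_of_degree_lt dlt)

lemma ph_ne_zero (G : SimpleGraph V) (S : Finset V) : ph G S ≠ 0 :=
  (ph_monic G _ S rfl).1.ne_zero

lemma ph_rec (G : SimpleGraph V) (S : Finset V) (u : V) (hu : u ∈ S) [DecidablePred (fun v => G.Adj u v)] :
    ph G S = X * ph G (S.erase u) - ∑ v ∈ (S.erase u).filter (fun v => G.Adj u v),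
        ph G ((S.erase u).erase v) := by
  have := mp_rec G (fun _ => (X : ℝ[X])) S u hu
  unfold ph
  convert this

lemma ph_deriv (G : SimpleGraph V) : ∀ (n : ℕ) (S : Finset V), S.card = n →
    derivative (ph G S) = ∑ v ∈ S, ph G (S.erase v) := by
  classical
  intro n
  induction n using Nat.strong_induction_on with
  | _ n ih =>
    intro S hS
    rcases S.eq_empty_or_nonempty with rfl | ⟨u, hu⟩
    · simp [ph, mp_empty]
    · have hlt : (S.erase u).card < n := hS ▸ Finset.card_erase_lt_of_mem hu
      rw [ph_rec G S u hu, derivative_sub, derivative_mul, derivative_X, one_mul,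
        ih _ hlt _ rfl, derivative_sum, ← Finset.add_sum_erase S _ hu, add_sub_assoc]
      congr 1
      have h1 : ∀ y ∈ S.erase u, ph G (S.erase y) = X * ph G ((S.erase u).erase y)
          - ∑ v ∈ ((S.erase u).erase y).filter (fun v => G.Adj u v),
            ph G (((S.erase u).erase y).erase v) := by
        intro y hy
        rw [ph_rec G (S.erase y) u (Finset.mem_erase.2 ⟨(Finset.mem_erase.1 hy).1.symm, hu⟩),
          Finset.erase_right_comm (a := y) (b := u)]
      rw [Finset.sum_congr rfl h1, Finset.sum_sub_distrib, Finset.mul_sum]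
      congr 1
      have h2 : ∀ v ∈ (S.erase u).filter (fun v => G.Adj u v),
          derivative (ph G ((S.erase u).erase v)) =
            ∑ y ∈ (S.erase u).erase v, ph G (((S.erase u).erase v).erase y) := by
        intro v hv
        exact ih _ (lt_of_le_of_lt (Finset.card_erase_le) hlt) _ rfl
      rw [Finset.sum_congr rfl h2]
      rw [Finset.sum_comm' (t' := S.erase u)
        (s' := fun y => ((S.erase u).erase y).filter (fun v => G.Adj u v))]
      · refine Finset.sum_congr rfl fun y hy => Finset.sum_congr rfl fun v hv => ?_
        rw [Finset.erase_right_comm (a := v) (b := y)]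
      · intro y v
        simp only [Finset.mem_filter, Finset.mem_erase]
        tauto

/-- multiplicity -/
noncomputable def mu (θ : ℝ) (G : SimpleGraph V) (S : Finset V) : ℕ :=
  rootMultiplicity θ (ph G S)

lemma exists_factor (θ : ℝ) (G : SimpleGraph V) (S : Finset V) :
    ∃ f : ℝ[X], ph G S = (X - C θ) ^ (mu θ G S) * f ∧ f.eval θ ≠ 0 := by
  obtain ⟨f, hf, hnd⟩ := exists_eq_pow_rootMultiplicity_mul_and_not_dvd (ph G S) (ph_ne_zero G S) θ
  exact ⟨f, hf, fun h => hnd (dvd_iff_isRoot.2 h)⟩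

lemma exists_factor_le (θ : ℝ) (G : SimpleGraph V) (S : Finset V) (k : ℕ) (hk : k ≤ mu θ G S) :
    ∃ f : ℝ[X], ph G S = (X - C θ) ^ k * f := by
  obtain ⟨f, hf, -⟩ := exists_factor θ G S
  exact (pow_dvd_pow _ hk).trans ⟨f, hf⟩

lemma nonneg_at (θ : ℝ) (m : ℕ) (r : ℝ[X])
    (h : ∀ t : ℝ, 0 ≤ ((X - C θ) ^ (2 * m) * r).eval t) : 0 ≤ r.eval θ := by
  by_contra hneg
  push Not at hneg
  have hc : ContinuousAt (fun t => r.eval t) θ := r.continuous.continuousAt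
  have hev := hc.eventually (gt_mem_nhds hneg)
  obtain ⟨ε, hε, hb⟩ := Metric.eventually_nhds_iff.1 hev
  have h1 := hb (y := θ + ε / 2) (by rw [Real.dist_eq]; rw [abs_of_pos] <;> linarith)
  have h2 := h (θ + ε / 2)
  simp only [eval_mul, eval_pow, eval_sub, eval_X, eval_C, add_sub_cancel_left] at h2
  have : 0 < (ε / 2) ^ (2 * m) := by positivity
  nlinarith

lemma wronskian_ge (G : SimpleGraph V) (S : Finset V) (u : V) (hu : u ∈ S) (t : ℝ) :
    0 ≤ (derivative (ph G S) * ph G (S.erase u) - ph G S * derivative (ph G (S.erase u))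
      - ph G (S.erase u) ^ 2).eval t := by
  rw [ph_deriv G _ S rfl, ph_deriv G _ (S.erase u) rfl, ← Finset.add_sum_erase S _ hu]
  have : (ph G (S.erase u) + ∑ v ∈ S.erase u, ph G (S.erase v)) * ph G (S.erase u)
      - ph G S * ∑ v ∈ S.erase u, ph G ((S.erase u).erase v) - ph G (S.erase u) ^ 2
      = ∑ v ∈ S.erase u, (ph G (S.erase u) * ph G (S.erase v)
        - ph G S * ph G ((S.erase u).erase v)) := by
    rw [Finset.sum_sub_distrib, ← Finset.mul_sum, ← Finset.mul_sum]; ring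
  rw [this, eval_finsetSum]
  refine Finset.sum_nonneg fun v hv => ?_
  have := hl G (fun _ => t) _ S rfl u v hu (Finset.mem_of_mem_erase hv)
    (Finset.mem_erase.1 hv).1.symm
  simpa [ph_eval] using this

lemma interlace (θ : ℝ) (G : SimpleGraph V) (S : Finset V) (u : V) (hu : u ∈ S) :
    mu θ G S ≤ mu θ G (S.erase u) + 1 := by
  by_contra hlt
  push Not at hlt
  obtain ⟨g, hg, hg0⟩ := exists_factor θ G (S.erase u)
  set m := mu θ G (S.erase u)
  obtain ⟨f, hf⟩ := exists_factor_le θ G S (m + 2) (by omega)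
  have hW := wronskian_ge G S u hu
  have key : derivative (ph G S) * ph G (S.erase u) - ph G S * derivative (ph G (S.erase u))
      - ph G (S.erase u) ^ 2 = (X - C θ) ^ (2 * m) * ((X - C θ) * (C ((m : ℝ) + 2) * f * g
        + (X - C θ) * derivative f * g - C (m : ℝ) * f * g
        - (X - C θ) * f * derivative g) - g ^ 2) := by
    rw [hf, hg]
    rcases m with _ | j
    · simp [derivative_mul, derivative_pow]; ring
    · simp only [derivative_mul, derivative_X_sub_C_pow]
      push_cast
      simp
      ring
  rw [key] at hW
  have := nonneg_at θ m _ hW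
  simp at this
  exact hg0 this

/-- sign at an essential vertex -/
lemma sign_pos (θ : ℝ) (G : SimpleGraph V) (S : Finset V) (u : V) (hu : u ∈ S) (m : ℕ)
    (f g : ℝ[X]) (hf : ph G S = (X - C θ) ^ (m + 1) * f)
    (hg : ph G (S.erase u) = (X - C θ) ^ m * g) : (g.eval θ) ^ 2 ≤ f.eval θ * g.eval θ := by
  have hW := wronskian_ge G S u hu
  have key : derivative (ph G S) * ph G (S.erase u) - ph G S * derivative (ph G (S.erase u))
      - ph G (S.erase u) ^ 2 = (X - C θ) ^ (2 * m) * ((C ((m : ℝ) + 1) * f * g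
        + (X - C θ) * derivative f * g - C (m : ℝ) * f * g
        - (X - C θ) * f * derivative g) - g ^ 2) := by
    rw [hf, hg]
    rcases m with _ | j
    · simp [derivative_mul, derivative_pow]; ring
    · simp only [derivative_mul, derivative_X_sub_C_pow]
      push_cast
      simp
      ring
  rw [key] at hW
  have := nonneg_at θ m _ hW
  simp at this
  linarith

/-- no neighbour of an essential vertex `u` is essential in the graph minus `u` -/
lemma claim_adj (θ : ℝ) (G : SimpleGraph V) (S : Finset V) (u v : V) (hu : u ∈ S) (hv : v ∈ S)
    (hadj : G.Adj u v) (hess : mu θ G (S.erase u) + 1 = mu θ G S) :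
    mu θ G ((S.erase u).erase v) + 2 ≠ mu θ G S := by
  classical
  intro hbad
  set j := mu θ G ((S.erase u).erase v) with hj
  obtain ⟨f, hf⟩ := exists_factor_le θ G S (j + 2) (by omega)
  obtain ⟨g, hg⟩ := exists_factor_le θ G (S.erase u) (j + 1) (by omega)
  have hvS : v ∈ S.erase u := Finset.mem_erase.2 ⟨hadj.ne', hv⟩
  have hex : ∀ y, ∃ h : ℝ[X], y ∈ S.erase u → ph G ((S.erase u).erase y) = (X - C θ) ^ j * h := by
    intro y
    by_cases hy : y ∈ S.erase u
    · have := interlace θ G (S.erase u) y hy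
      obtain ⟨h, hh⟩ := exists_factor_le θ G ((S.erase u).erase y) j (by omega)
      exact ⟨h, fun _ => hh⟩
    · exact ⟨0, fun h => absurd h hy⟩
  choose h hh using hex
  have hrec := ph_rec G S u hu
  rw [Finset.sum_congr rfl (fun y hy => hh y (Finset.mem_filter.1 hy).1), ← Finset.mul_sum,
    hf, hg] at hrec
  have hX : (X - C θ : ℝ[X]) ^ j ≠ 0 := pow_ne_zero _ (X_sub_C_ne_zero θ)
  have hrec2 : (X - C θ) ^ 2 * f = X * ((X - C θ) * g) -
      ∑ y ∈ (S.erase u).filter (fun v => G.Adj u v), h y := by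
    apply mul_left_cancel₀ hX
    linear_combination hrec
  have hev := congrArg (fun p => eval θ p * eval θ g) hrec2
  simp only [eval_mul, eval_pow, eval_sub, eval_X, eval_C, sub_self, eval_finsetSum] at hev
  have hs : ∑ y ∈ (S.erase u).filter (fun v => G.Adj u v), (eval θ g * eval θ (h y)) = 0 := by
    rw [← Finset.mul_sum]; linarith
  have hsg : ∀ y ∈ (S.erase u).filter (fun v => G.Adj u v),
      (eval θ (h y)) ^ 2 ≤ eval θ g * eval θ (h y) := by
    intro y hy
    have hy' := (Finset.mem_filter.1 hy).1
    exact sign_pos θ G (S.erase u) y hy' j g (h y) hg (hh y hy')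
  have hz := (Finset.sum_eq_zero_iff_of_nonneg
    (fun y hy => (sq_nonneg _).trans (hsg y hy))).1 hs v (Finset.mem_filter.2 ⟨hvS, hadj⟩)
  have hv0 : eval θ (h v) = 0 := by
    have := hsg v (Finset.mem_filter.2 ⟨hvS, hadj⟩)
    rw [hz] at this
    exact pow_eq_zero_iff (two_ne_zero) |>.1 (le_antisymm this (sq_nonneg _))
  obtain ⟨h', hh', hne⟩ := exists_factor θ G ((S.erase u).erase v)
  rw [hh v hvS, ← hj] at hh'
  rw [mul_left_cancel₀ hX hh'] at hv0
  exact hne hv0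

lemma claim_trans (θ : ℝ) (G : SimpleGraph V) (S : Finset V) (u v w : V) (hu : u ∈ S) (hv : v ∈ S)
    (hw : w ∈ S) (huv : u ≠ v) (huw : u ≠ w) (hvw : v ≠ w)
    (hess : mu θ G (S.erase w) + 1 = mu θ G S)
    (h1 : mu θ G ((S.erase u).erase w) + 2 ≠ mu θ G S)
    (h2 : mu θ G ((S.erase w).erase v) + 2 ≠ mu θ G S) :
    mu θ G ((S.erase u).erase v) + 2 ≠ mu θ G S := by
  classical
  intro hbad
  have mem : ∀ {a b : V}, a ∈ S → a ≠ b → a ∈ S.erase b := fun h h' => Finset.mem_erase.2 ⟨h', h⟩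
  have iu := interlace θ G S u hu
  have iv := interlace θ G S v hv
  have iuw := interlace θ G (S.erase u) w (mem hw huw.symm)
  have iwv := interlace θ G (S.erase w) v (mem hv hvw)
  have iuwv := interlace θ G ((S.erase u).erase w) v (Finset.mem_erase.2 ⟨hvw, mem hv huv.symm⟩)
  obtain ⟨Auv, eAuv, nAuv⟩ := exists_factor θ G ((S.erase u).erase v)
  obtain ⟨Aw, eAw, nAw⟩ := exists_factor θ G (S.erase w)
  set j := mu θ G ((S.erase u).erase v)
  rw [show mu θ G (S.erase w) = j + 1 by omega] at eAw
  obtain ⟨A, eA⟩ := exists_factor_le θ G S (j + 2) (by omega)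
  obtain ⟨Au, eAu⟩ := exists_factor_le θ G (S.erase u) (j + 1) (by omega)
  obtain ⟨Av, eAv⟩ := exists_factor_le θ G (S.erase v) (j + 1) (by omega)
  obtain ⟨Auw, eAuw⟩ := exists_factor_le θ G ((S.erase u).erase w) (j + 1) (by omega)
  obtain ⟨Awv, eAwv⟩ := exists_factor_le θ G ((S.erase w).erase v) (j + 1) (by omega)
  obtain ⟨Auwv, eAuwv⟩ := exists_factor_le θ G (((S.erase u).erase w).erase v) j (by omega)
  set s : ℝ := (- Au.eval θ - Aw.eval θ) / Auv.eval θ with hs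
  have hpos : ∀ t : ℝ, 0 ≤ ((X - C θ) ^ (2 * (j + 1)) *
      ((Au + C s * Auv) * (Aw + C s * (X - C θ) * Awv)
        - ((X - C θ) * A + C s * (X - C θ) * Av) * (Auw + C s * Auwv))).eval t := by
    intro t
    have := hl G (Function.update (fun _ => t) v (t + s * (t - θ))) _ S rfl u w hu hw huw
    rw [mp_shift _ _ _ _ _ (mem hv huv.symm), mp_shift _ _ _ _ _ (mem hv hvw),
      mp_shift _ _ _ _ _ hv,
      mp_shift _ _ _ _ _ (Finset.mem_erase.2 ⟨hvw, mem hv huv.symm⟩),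
      eAuv, eAw, eA, eAu, eAv, eAuw, eAwv, eAuwv] at this
    simp only [eval_mul, eval_pow, eval_sub, eval_X, eval_C, eval_add] at this ⊢
    refine this.trans_eq ?_
    ring
  have := nonneg_at θ _ _ hpos
  simp only [eval_mul, eval_pow, eval_sub, eval_X, eval_C, eval_add, sub_self] at this
  have hss : s * Auv.eval θ = - Au.eval θ - Aw.eval θ := by rw [hs]; field_simp
  rw [hss] at this
  have hpos2 : 0 < (Aw.eval θ) ^ 2 := by positivity
  nlinarith

lemma no_bad (θ : ℝ) (G : SimpleGraph V)
    (hess : ∀ w, mu θ G (univ.erase w) + 1 = mu θ G univ) (u v : V) (hr : G.Reachable u v) :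
    u ≠ v → mu θ G ((univ.erase u).erase v) + 2 ≠ mu θ G univ := by
  rw [SimpleGraph.reachable_iff_reflTransGen] at hr
  induction hr with
  | refl => intro h; exact absurd rfl h
  | @tail w v _ hadj ih =>
    intro huv
    by_cases huw : u = w
    · subst huw
      exact claim_adj θ G univ u v (mem_univ _) (mem_univ _) hadj (hess u)
    · exact claim_trans θ G univ u v w (mem_univ _) (mem_univ _) (mem_univ _) huv huw hadj.ne'
        (hess w) (ih huw) (claim_adj θ G univ w v (mem_univ _) (mem_univ _) hadj (hess w))

/-- vertices covered by a matching -/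
lemma card_uncovered (G : SimpleGraph V) (M : Finset (Sym2 V)) [DecidablePred (fun v => ∀ e ∈ M, v ∉ e)] 
    (S : Finset V) (hM : M ∈ ms G S) :
    (S.filter (fun v => ∀ e ∈ M, v ∉ e)).card = S.card - 2 * M.card := by
  classical
  obtain ⟨h1, h2, h3⟩ := mem_ms.1 hM
  have hcov : S.filter (fun v => ¬ ∀ e ∈ M, v ∉ e) = M.biUnion (fun e => e.toFinset) := by
    ext y
    simp only [Finset.mem_filter, Finset.mem_biUnion, Sym2.mem_toFinset]
    push Not
    constructor
    · rintro ⟨_, h⟩; exact h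
    · rintro ⟨e, he, hy⟩; exact ⟨h3 e he y hy, e, he, hy⟩
  have hc2 : (M.biUnion (fun e => e.toFinset)).card = 2 * M.card := by
    rw [Finset.card_biUnion, Finset.sum_congr rfl (g := fun _ => 2), Finset.sum_const, smul_eq_mul,
      mul_comm]
    · intro e he
      exact Sym2.card_toFinset_of_not_isDiag e (G.not_isDiag_of_mem_edgeSet (h1 e he))
    · intro e he f hf hne
      refine Finset.disjoint_left.2 fun y hy hy' => ?_
      rw [Sym2.mem_toFinset] at hy hy'
      exact h2 e he f hf hne y hy hy'
  have := Finset.card_filter_add_card_filter_not (s := S) (fun v => ∀ e ∈ M, v ∉ e)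
  rw [hcov, hc2] at this
  omega

lemma matchingPolynomial_eq {W : Type*} [Finite W] (H : SimpleGraph W) (G : SimpleGraph V)
    (f : W ↪ V) (hG : ∀ a b, H.Adj a b ↔ G.Adj (f a) (f b)) (S : Finset V)
    (hS : ∀ v, v ∈ S ↔ ∃ a, f a = v) : matchingPolynomial H = ph G S := by
  classical
  have : Fintype W := Fintype.ofFinite W
  have hcard : Nat.card W = S.card := by
    have : S = Finset.univ.map f := by ext y; simp [hS]
    rw [this, Finset.card_map, Finset.card_univ, Nat.card_eq_fintype_card]
  have hadj : ∀ e : Sym2 W, e ∈ H.edgeSet ↔ Sym2.map f e ∈ G.edgeSet := by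
    intro e
    induction e using Sym2.ind with
    | _ a b => simpa using hG a b
  unfold matchingPolynomial ph mp
  refine Finset.sum_bij (fun M _ => M.map ⟨Sym2.map f, Sym2.map.injective f.injective⟩) ?_ ?_ ?_ ?_
  · intro M hM
    simp only [Finset.mem_filter, Finset.mem_univ, true_and] at hM
    rw [mem_ms]
    simp only [Finset.mem_map, Function.Embedding.coeFn_mk]
    refine ⟨?_, ?_, ?_⟩
    · rintro _ ⟨e, he, rfl⟩
      exact (hadj e).1 (hM.1 e he)
    · rintro _ ⟨e, he, rfl⟩ _ ⟨e', he', rfl⟩ hne y hy hy'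
      rw [Sym2.mem_map] at hy hy'
      obtain ⟨a, ha, rfl⟩ := hy
      obtain ⟨b, hb, hab⟩ := hy'
      have hab := f.injective hab
      subst hab
      exact hM.2 e he e' he' (fun h => hne (by rw [h])) _ ha hb
    · rintro _ ⟨e, he, rfl⟩ y hy
      rw [Sym2.mem_map] at hy
      obtain ⟨a, ha, rfl⟩ := hy
      exact (hS _).2 ⟨a, rfl⟩
  · intro M _ N _ h
    exact Finset.map_injective _ h
  · intro N hN
    obtain ⟨h1, h2, h3⟩ := mem_ms.1 hN
    have hpre : ∀ e ∈ N, ∃ e' : Sym2 W, Sym2.map f e' = e := by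
      intro e he
      induction e using Sym2.ind with
      | _ a b =>
        obtain ⟨a', rfl⟩ := (hS a).1 (h3 _ he a (by simp))
        obtain ⟨b', rfl⟩ := (hS b).1 (h3 _ he b (by simp))
        exact ⟨s(a', b'), by simp⟩
    refine ⟨Finset.univ.filter (fun e => Sym2.map f e ∈ N), ?_, ?_⟩
    · simp only [Finset.mem_filter, Finset.mem_univ, true_and]
      refine ⟨fun e he => (hadj e).2 (h1 _ he), ?_⟩
      intro e he e' he' hne v hv hv'
      exact h2 _ he _ he' (fun h => hne (Sym2.map.injective f.injective h)) (f v)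
        (Sym2.mem_map.2 ⟨v, hv, rfl⟩) (Sym2.mem_map.2 ⟨v, hv', rfl⟩)
    · ext e
      simp only [Finset.mem_map, Finset.mem_filter, Finset.mem_univ, true_and,
        Function.Embedding.coeFn_mk]
      constructor
      · rintro ⟨e', he', rfl⟩; exact he'
      · intro he
        obtain ⟨e', rfl⟩ := hpre e he
        exact ⟨e', he, rfl⟩
  · intro M hM
    have hmem : M.map ⟨Sym2.map f, Sym2.map.injective f.injective⟩ ∈ ms G S := by
      simp only [Finset.mem_filter, Finset.mem_univ, true_and] at hM
      rw [mem_ms]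
      simp only [Finset.mem_map, Function.Embedding.coeFn_mk]
      refine ⟨?_, ?_, ?_⟩
      · rintro _ ⟨e, he, rfl⟩
        exact (hadj e).1 (hM.1 e he)
      · rintro _ ⟨e, he, rfl⟩ _ ⟨e', he', rfl⟩ hne y hy hy'
        rw [Sym2.mem_map] at hy hy'
        obtain ⟨a, ha, rfl⟩ := hy
        obtain ⟨b, hb, hab⟩ := hy'
        have hab := f.injective hab
        subst hab
        exact hM.2 e he e' he' (fun h => hne (by rw [h])) _ ha hb
      · rintro _ ⟨e, he, rfl⟩ y hy
        rw [Sym2.mem_map] at hy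
        obtain ⟨a, ha, rfl⟩ := hy
        exact (hS _).2 ⟨a, rfl⟩
    rw [Finset.prod_const, card_uncovered G _ S hmem, Finset.card_map, hcard]

end MatchAux

-- statement 15
theorem critical_delete_vertex_no_essential {V : Type*} [Finite V] (θ : ℝ)
    (G : SimpleGraph V) (hconn : G.Connected) (hcrit : ∀ u : V, IsEssential θ G u)
    (u : V) (w : V) (hw : w ≠ u) :
    ¬ IsEssential θ (G.induce {v | v ≠ u}) ⟨w, hw⟩ := by
  classical
  have : Fintype V := Fintype.ofFinite V
  have h0 : matchMult θ G = MatchAux.mu θ G Finset.univ := by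
    unfold matchMult MatchAux.mu
    rw [MatchAux.matchingPolynomial_eq G G (Function.Embedding.refl V) (by simp) Finset.univ
      (by simp)]
  have h1 : ∀ x, matchMult θ (G.induce {v | v ≠ x}) = MatchAux.mu θ G (Finset.univ.erase x) := by
    intro x
    unfold matchMult MatchAux.mu
    rw [MatchAux.matchingPolynomial_eq (G.induce {v | v ≠ x}) G (Function.Embedding.subtype _)
      (by simp) (Finset.univ.erase x) (by simp)]
  have h2 : matchMult θ ((G.induce {v | v ≠ u}).induce {v | v ≠ ⟨w, hw⟩})
      = MatchAux.mu θ G ((Finset.univ.erase u).erase w) := by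
    unfold matchMult MatchAux.mu
    rw [MatchAux.matchingPolynomial_eq ((G.induce {v | v ≠ u}).induce {v | v ≠ ⟨w, hw⟩}) G
      ((Function.Embedding.subtype _).trans (Function.Embedding.subtype _))
      (by simp) ((Finset.univ.erase u).erase w) (by
        intro v
        simp only [Finset.mem_erase, Finset.mem_univ, and_true]
        constructor
        · rintro ⟨ha, hb⟩
          exact ⟨⟨⟨v, hb⟩, fun h => ha (congrArg Subtype.val h)⟩, rfl⟩
        · rintro ⟨⟨⟨a, ha⟩, hb⟩, rfl⟩
          exact ⟨fun h => hb (Subtype.ext h), ha⟩)]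
  have hess : ∀ x, MatchAux.mu θ G (Finset.univ.erase x) + 1 = MatchAux.mu θ G Finset.univ := by
    intro x
    have := hcrit x
    unfold IsEssential at this
    rwa [h1, h0] at this
  intro hE
  unfold IsEssential at hE
  rw [h2, h1] at hE
  have := MatchAux.no_bad θ G hess u w (hconn.preconnected u w) hw.symm
  have := hess u
  omega
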